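/- arXiv:2311.18343 — 3 statements merged into one kernel-verified Lean document; each statement's English description precedes it below -/
import Mathlib

section
/- In the correlated Rayleigh cascaded-channel model with two APs m ≠ n whose fading matrices D_m, D_n are independent of each other and of c_k, and with a common UE channel q_k, for all deterministic matrices A, B ∈ ℂ^{L×L}: E[(h_mk^H A h_mk)(h_nk^H B h_nk)] = tr(R_AP,m A) · tr(R_AP,n B) · ( tr(R̃_mk) tr(R̃_nk) + tr(R̃_mk R̃_nk) ). -/
open MeasureTheory ProbabilityTheory Matrix
open scoped ComplexOrder

/-- The standard complex Gaussian measure `CN(0,1)` on `ℂ`: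
the law of `(a + i b)/√2` with `a, b` independent standard real Gaussians. -/
noncomputable def stdCGauss : Measure ℂ :=
  Measure.map (fun p : ℝ × ℝ => ((p.1 : ℂ) + (p.2 : ℂ) * Complex.I) / (Real.sqrt 2 : ℂ))
    ((gaussianReal 0 1).prod (gaussianReal 0 1))

/-- The law of a standard complex Gaussian random vector with i.i.d. `CN(0,1)` coordinates. -/
noncomputable def stdCGaussPi (ι : Type) [Fintype ι] : Measure (ι → ℂ) :=
  Measure.pi fun _ => stdCGauss

/-- The law of a standard complex Gaussian random matrix with i.i.d. `CN(0,1)` entries. -/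
noncomputable def stdCGaussMat (ι κ : Type) [Fintype ι] [Fintype κ] : Measure (ι → κ → ℂ) :=
  Measure.pi fun _ => stdCGaussPi κ

/-- Entrywise expectation of a random complex matrix. -/
noncomputable def matExp {Ω n m : Type} [MeasurableSpace Ω] (μ : Measure Ω)
    (X : Ω → Matrix n m ℂ) : Matrix n m ℂ :=
  Matrix.of fun i j => ∫ ω, X ω i j ∂μ

/-- The AP–RIS channel matrix `W = √β̃ · R_RIS^{1/2} D R_AP^{1/2}` (with `S = R^{1/2}`). -/
noncomputable def Wmat {N L : ℕ} (βm : ℝ) (SRISm : Matrix (Fin N) (Fin N) ℂ)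
    (SAP : Matrix (Fin L) (Fin L) ℂ) (Dω : Fin N → Fin L → ℂ) :
    Matrix (Fin N) (Fin L) ℂ :=
  (Real.sqrt βm : ℂ) • (SRISm * Matrix.of Dω * SAP)

/-- The RIS–UE channel vector `q = √β̃ · R_RIS^{1/2} c` (with `S = R^{1/2}`). -/
noncomputable def qVec {N : ℕ} (βu : ℝ) (SRISu : Matrix (Fin N) (Fin N) ℂ)
    (cω : Fin N → ℂ) : Fin N → ℂ :=
  (Real.sqrt βu : ℂ) • (SRISu *ᵥ cω)

/-- The cascaded channel `h = Wᴴ Φ q`. -/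
noncomputable def hChan {N L : ℕ} (βm : ℝ) (SRISm : Matrix (Fin N) (Fin N) ℂ)
    (SAP : Matrix (Fin L) (Fin L) ℂ) (Φ : Matrix (Fin N) (Fin N) ℂ)
    (βu : ℝ) (SRISu : Matrix (Fin N) (Fin N) ℂ)
    (Dω : Fin N → Fin L → ℂ) (cω : Fin N → ℂ) : Fin L → ℂ :=
  (Wmat βm SRISm SAP Dω)ᴴ *ᵥ (Φ *ᵥ qVec βu SRISu cω)

/-- `R̃ = β̃_m β̃_u · R_RIS,m Φ R_RIS,u Φᴴ`. -/
noncomputable def Rtil {N : ℕ} (βm βu : ℝ) (RRISm Φ RRISu : Matrix (Fin N) (Fin N) ℂ) :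
    Matrix (Fin N) (Fin N) ℂ :=
  ((βm * βu : ℝ) : ℂ) • (RRISm * Φ * RRISu * Φᴴ)

theorem integrable_pow_gaussianReal (n : ℕ) :
    Integrable (fun x : ℝ => x ^ n) (gaussianReal 0 1) := by
  have h : MemLp (id : ℝ → ℝ) n (gaussianReal 0 1) := memLp_id_gaussianReal' _ (by simp)
  refine h.integrable_norm_pow'.mono' (by fun_prop) ?_
  exact Filter.Eventually.of_forall fun x => by simp

theorem integrable_pow_mul_pow_gaussianReal_prod (a b : ℕ) :
    Integrable (fun p : ℝ × ℝ => p.1 ^ a * p.2 ^ b)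
      ((gaussianReal 0 1).prod (gaussianReal 0 1)) :=
  (integrable_pow_gaussianReal a).mul_prod (integrable_pow_gaussianReal b)

theorem integral_pow_mul_pow_gaussianReal_prod (a b : ℕ) :
    ∫ p : ℝ × ℝ, p.1 ^ a * p.2 ^ b ∂((gaussianReal 0 1).prod (gaussianReal 0 1))
      = (∫ x, x ^ a ∂(gaussianReal 0 1)) * ∫ x, x ^ b ∂(gaussianReal 0 1) :=
  integral_prod_mul (fun x : ℝ => x ^ a) (fun x : ℝ => x ^ b)

theorem integral_sq_gaussianReal : ∫ x, x ^ 2 ∂(gaussianReal 0 1) = 1 := by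
  have h := variance_id_gaussianReal (μ := 0) (v := 1)
  rw [variance_of_integral_eq_zero (by fun_prop) (by simp [integral_id_gaussianReal])] at h
  simpa using h

/-- The fourth moment follows from the invariance of the law under `(X, Y) ↦ (X + Y) / √2`. -/
theorem integral_pow_four_gaussianReal : ∫ x, x ^ 4 ∂(gaussianReal 0 1) = 3 := by
  have hmap : ((gaussianReal 0 1).prod (gaussianReal 0 1)).map (fun p : ℝ × ℝ => p.1 + p.2)
      = (gaussianReal 0 1).map (fun x => Real.sqrt 2 * x) := by
    have h := gaussianReal_conv_gaussianReal (m₁ := 0) (m₂ := 0) (v₁ := 1) (v₂ := 1)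
    rw [Measure.conv] at h
    rw [h, gaussianReal_map_const_mul]
    congr 1
    · simp
    · ext; simp; norm_num
  have h : ∫ x, x ^ 4 ∂_ = ∫ x, x ^ 4 ∂_ := congrArg (fun ν : Measure ℝ => ∫ x, x ^ 4 ∂ν) hmap
  rw [integral_map (by fun_prop) (by fun_prop), integral_map (by fun_prop) (by fun_prop)] at h
  have hs : (Real.sqrt 2) ^ 4 = 4 := by
    rw [show (4 : ℕ) = 2 * 2 from rfl, pow_mul, Real.sq_sqrt (by norm_num)]; norm_num
  simp_rw [mul_pow, hs] at h
  rw [integral_const_mul] at h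
  have hi := integrable_pow_mul_pow_gaussianReal_prod
  have hv := integral_pow_mul_pow_gaussianReal_prod
  have he : (fun p : ℝ × ℝ => (p.1 + p.2) ^ 4) = fun p => p.1 ^ 4 * p.2 ^ 0
      + (4 * (p.1 ^ 3 * p.2 ^ 1) + (6 * (p.1 ^ 2 * p.2 ^ 2)
      + (4 * (p.1 ^ 1 * p.2 ^ 3) + p.1 ^ 0 * p.2 ^ 4))) := by
    ext p; ring
  have h1 : ∫ x, x ^ 1 ∂(gaussianReal 0 1) = 0 := by
    simp [integral_id_gaussianReal]
  rw [he, integral_add (hi _ _) (by fun_prop), integral_add ((hi _ _).const_mul _) (by fun_prop),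
    integral_add ((hi _ _).const_mul _) (by fun_prop),
    integral_add ((hi _ _).const_mul _) (hi _ _)] at h
  simp only [integral_const_mul, hv, integral_sq_gaussianReal, h1] at h
  simp at h
  linarith

instance : IsProbabilityMeasure stdCGauss :=
  Measure.isProbabilityMeasure_map (by fun_prop)

instance (ι : Type) [Fintype ι] : IsProbabilityMeasure (stdCGaussPi ι) := by
  unfold stdCGaussPi; infer_instance

instance (ι κ : Type) [Fintype ι] [Fintype κ] : IsProbabilityMeasure (stdCGaussMat ι κ) := by
  unfold stdCGaussMat; infer_instance

theorem norm_sq_div_sqrt_two (p : ℝ × ℝ) :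
    star (((p.1 : ℂ) + (p.2 : ℂ) * Complex.I) / (Real.sqrt 2 : ℂ))
      * (((p.1 : ℂ) + (p.2 : ℂ) * Complex.I) / (Real.sqrt 2 : ℂ))
      = (((p.1 ^ 2 + p.2 ^ 2) / 2 : ℝ) : ℂ) := by
  have h2 : (Real.sqrt 2 : ℂ) * (Real.sqrt 2 : ℂ) = 2 := by
    rw [← Complex.ofReal_mul, Real.mul_self_sqrt (by norm_num)]; norm_num
  simp only [star_div₀, star_add, star_mul', Complex.star_def, Complex.conj_ofReal, Complex.conj_I]
  rw [div_mul_div_comm, h2]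
  push_cast
  congr 1
  linear_combination (-(p.2 : ℂ) ^ 2) * Complex.I_sq

theorem integral_normSq_stdCGauss : ∫ z, star z * z ∂stdCGauss = 1 := by
  rw [stdCGauss, integral_map (by fun_prop) (by fun_prop)]
  simp_rw [norm_sq_div_sqrt_two]
  rw [integral_complex_ofReal, integral_div, integral_add
    ((integrable_pow_gaussianReal 2).comp_fst _) ((integrable_pow_gaussianReal 2).comp_snd _),
    integral_fun_fst (fun x : ℝ => x ^ 2), integral_fun_snd (fun x : ℝ => x ^ 2),
    integral_sq_gaussianReal]
  norm_num

theorem integral_normSq_sq_stdCGauss : ∫ z, star z ^ 2 * z ^ 2 ∂stdCGauss = 2 := by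
  have hi := integrable_pow_mul_pow_gaussianReal_prod
  have hv := integral_pow_mul_pow_gaussianReal_prod
  have he : (fun p : ℝ × ℝ => ((p.1 ^ 2 + p.2 ^ 2) / 2) ^ 2) = fun p =>
      (p.1 ^ 4 * p.2 ^ 0 + (2 * (p.1 ^ 2 * p.2 ^ 2) + p.1 ^ 0 * p.2 ^ 4)) / 4 := by
    ext p; ring
  rw [stdCGauss, integral_map (by fun_prop) (by fun_prop)]
  simp_rw [← mul_pow, norm_sq_div_sqrt_two, ← Complex.ofReal_pow]
  rw [integral_complex_ofReal, he, integral_div,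
    integral_add (hi _ _) (by fun_prop),
    integral_add ((hi _ _).const_mul _) (hi _ _), integral_const_mul, hv, hv, hv,
    integral_sq_gaussianReal, integral_pow_four_gaussianReal]
  norm_num

theorem integrable_star_pow_mul_pow_stdCGauss (a b : ℕ) :
    Integrable (fun z : ℂ => star z ^ a * z ^ b) stdCGauss := by
  rw [stdCGauss, integrable_map_measure (by fun_prop) (by fun_prop)]
  have hs (f : ℝ × ℝ → ℝ) (hf : MemLp f (a + b : ℕ) ((gaussianReal 0 1).prod (gaussianReal 0 1))) :
      MemLp (fun p => (f p : ℂ)) (a + b : ℕ) ((gaussianReal 0 1).prod (gaussianReal 0 1)) :=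
    hf.ofReal
  have h : MemLp (id : ℝ → ℝ) (a + b : ℕ) (gaussianReal 0 1) :=
    memLp_id_gaussianReal' _ (by simp)
  have hz : MemLp (fun p : ℝ × ℝ => ((p.1 : ℂ) + (p.2 : ℂ) * Complex.I) / (Real.sqrt 2 : ℂ))
      (a + b : ℕ) ((gaussianReal 0 1).prod (gaussianReal 0 1)) := by
    simp_rw [div_eq_mul_inv]
    exact ((hs _ (h.comp_fst _)).add ((hs _ (h.comp_snd _)).mul_const _)).mul_const _
  refine hz.integrable_norm_pow'.mono' (by fun_prop) ?_
  exact Filter.Eventually.of_forall fun p => by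
    simp only [Function.comp_apply, norm_mul, norm_pow, norm_star, pow_add, le_refl]

theorem map_I_mul_stdCGauss : stdCGauss.map (fun z => Complex.I * z) = stdCGauss := by
  have hrot : ((gaussianReal 0 1).prod (gaussianReal 0 1)).map (fun p : ℝ × ℝ => (-p.2, p.1))
      = (gaussianReal 0 1).prod (gaussianReal 0 1) := by
    have h : (fun p : ℝ × ℝ => (-p.2, p.1)) = Prod.map (fun x => -x) id ∘ Prod.swap := rfl
    rw [h, ← Measure.map_map (by fun_prop) measurable_swap, Measure.prod_swap,
      ← Measure.map_prod_map _ _ (by fun_prop) (by fun_prop), gaussianReal_map_neg, Measure.map_id,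
      neg_zero]
  rw [stdCGauss, Measure.map_map (by fun_prop) (by fun_prop)]
  conv_rhs => rw [← hrot]
  rw [Measure.map_map (by fun_prop) (by fun_prop)]
  congr 1
  ext p
  simp only [Function.comp_apply, Complex.ofReal_neg]
  linear_combination ((p.2 : ℂ) / (Real.sqrt 2 : ℂ)) * Complex.I_sq

/-- The mixed moments are invariant under multiplication by `I`. -/
theorem integral_star_pow_mul_pow_stdCGauss_eq (a b : ℕ) :
    ∫ z, star z ^ a * z ^ b ∂stdCGauss
      = (-Complex.I) ^ a * Complex.I ^ b * ∫ z, star z ^ a * z ^ b ∂stdCGauss := by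
  conv_lhs => rw [← map_I_mul_stdCGauss]
  rw [integral_map (by fun_prop) (by fun_prop), ← integral_const_mul]
  congr 1
  ext z
  simp only [star_mul', Complex.star_def, Complex.conj_I]
  ring

theorem integral_star_pow_mul_pow_stdCGauss {a b : ℕ} (ha : a ≤ 2) (hb : b ≤ 2) :
    ∫ z, star z ^ a * z ^ b ∂stdCGauss = if a = b then (a.factorial : ℂ) else 0 := by
  have key := integral_star_pow_mul_pow_stdCGauss_eq a b
  split_ifs with hab
  · subst hab
    interval_cases a
    · simp
    · simpa using integral_normSq_stdCGauss
    · simpa using integral_normSq_sq_stdCGauss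
  · have hne : (-Complex.I) ^ a * Complex.I ^ b ≠ 1 := by
      interval_cases a <;> interval_cases b <;> simp_all [Complex.ext_iff, pow_two] <;> norm_num
    by_contra h0
    exact hne (mul_right_cancel₀ h0 (by rw [one_mul]; exact key.symm))

section Moments

variable {ι κ : Type} [Fintype ι] [Fintype κ]

theorem integrable_monomial_stdCGaussPi (a b : ι → ℕ) :
    Integrable (fun z : ι → ℂ => ∏ x, star (z x) ^ a x * z x ^ b x) (stdCGaussPi ι) :=
  Integrable.fintype_prod (f := fun x z => star z ^ a x * z ^ b x)
    fun x => integrable_star_pow_mul_pow_stdCGauss (a x) (b x)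

theorem integral_monomial_stdCGaussPi (a b : ι → ℕ) :
    ∫ z, ∏ x, star (z x) ^ a x * z x ^ b x ∂(stdCGaussPi ι)
      = ∏ x, ∫ z, star z ^ a x * z ^ b x ∂stdCGauss :=
  integral_fintype_prod_eq_prod fun x z => star z ^ a x * z ^ b x

theorem integrable_monomial_stdCGaussMat (a b : ι → κ → ℕ) :
    Integrable (fun z : ι → κ → ℂ => ∏ x, ∏ y, star (z x y) ^ a x y * z x y ^ b x y)
      (stdCGaussMat ι κ) :=
  Integrable.fintype_prod (f := fun x (z : κ → ℂ) => ∏ y, star (z y) ^ a x y * z y ^ b x y)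
    fun x => integrable_monomial_stdCGaussPi (a x) (b x)

theorem integral_monomial_stdCGaussMat (a b : ι → κ → ℕ) :
    ∫ z, ∏ x, ∏ y, star (z x y) ^ a x y * z x y ^ b x y ∂(stdCGaussMat ι κ)
      = ∏ x, ∏ y, ∫ z, star z ^ a x y * z ^ b x y ∂stdCGauss :=
  (integral_fintype_prod_eq_prod fun x (z : κ → ℂ) => ∏ y, star (z y) ^ a x y * z y ^ b x y).trans
    (Finset.prod_congr rfl fun x _ => integral_monomial_stdCGaussPi (a x) (b x))

variable [DecidableEq ι] [DecidableEq κ]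

theorem star_mul_mul_star_mul_eq_prod (i j k l : ι) (z : ι → ℂ) :
    star (z i) * z j * (star (z k) * z l)
      = ∏ x, star (z x) ^ ((if x = i then 1 else 0) + (if x = k then 1 else 0))
          * z x ^ ((if x = j then 1 else 0) + (if x = l then 1 else 0)) := by
  simp only [pow_add, Finset.prod_mul_distrib, pow_ite, pow_one, pow_zero, Finset.prod_ite_eq',
    Finset.mem_univ, if_true]
  ring

theorem mul_star_eq_prod_prod (i i' : ι) (l l' : κ) (z : ι → κ → ℂ) :
    z i l * star (z i' l')
      = ∏ x, ∏ y, star (z x y) ^ (if x = i' then if y = l' then 1 else 0 else 0)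
          * z x y ^ (if x = i then if y = l then 1 else 0 else 0) := by
  simp only [Finset.prod_mul_distrib, pow_ite, pow_one, pow_zero, Finset.prod_ite_irrel,
    Finset.prod_const_one, Finset.prod_ite_eq', Finset.mem_univ, if_true]
  ring

theorem integrable_star_mul_mul_star_mul (i j k l : ι) :
    Integrable (fun z : ι → ℂ => star (z i) * z j * (star (z k) * z l)) (stdCGaussPi ι) := by
  simp_rw [star_mul_mul_star_mul_eq_prod]
  exact integrable_monomial_stdCGaussPi _ _

theorem integrable_mul_star (i i' : ι) (l l' : κ) :
    Integrable (fun z : ι → κ → ℂ => z i l * star (z i' l')) (stdCGaussMat ι κ) := by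
  simp_rw [mul_star_eq_prod_prod]
  exact integrable_monomial_stdCGaussMat _ _

theorem integral_mul_star (i i' : ι) (l l' : κ) :
    ∫ z : ι → κ → ℂ, z i l * star (z i' l') ∂(stdCGaussMat ι κ)
      = if i = i' ∧ l = l' then 1 else 0 := by
  simp_rw [mul_star_eq_prod_prod]
  rw [integral_monomial_stdCGaussMat]
  have hle (x s : ι) (y t : κ) : (if x = s then if y = t then 1 else 0 else 0) ≤ 2 := by
    split_ifs <;> norm_num
  simp_rw [fun x y => integral_star_pow_mul_pow_stdCGauss (hle x i' y l') (hle x i y l)]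
  split_ifs with h
  · obtain ⟨rfl, rfl⟩ := h
    refine Finset.prod_eq_one fun x _ => Finset.prod_eq_one fun y _ => ?_
    split_ifs <;> simp_all
  · refine Finset.prod_eq_zero (Finset.mem_univ i) (Finset.prod_eq_zero (Finset.mem_univ l) ?_)
    rw [if_neg]
    split_ifs <;> simp_all

/-- **Isserlis' theorem** for fourth moments of a standard complex Gaussian vector. -/
theorem integral_star_mul_mul_star_mul (i j k l : ι) :
    ∫ z : ι → ℂ, star (z i) * z j * (star (z k) * z l) ∂(stdCGaussPi ι)
      = (if i = j ∧ k = l then 1 else 0) + (if i = l ∧ k = j then 1 else 0) := by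
  simp_rw [star_mul_mul_star_mul_eq_prod]
  rw [integral_monomial_stdCGaussPi]
  have hle (x s t : ι) : (if x = s then 1 else 0) + (if x = t then 1 else 0) ≤ 2 := by
    split_ifs <;> norm_num
  simp_rw [fun x => integral_star_pow_mul_pow_stdCGauss (hle x i k) (hle x j l)]
  have hfac : ∏ x, (((if x = i then 1 else 0) + (if x = k then 1 else 0) : ℕ).factorial : ℂ)
      = if i = k then 2 else 1 := by
    split_ifs with h
    · subst h
      rw [Finset.prod_eq_single i (fun x _ hx => by simp [hx]) (by simp)]
      simp
    · refine Finset.prod_eq_one fun x _ => ?_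
      split_ifs <;> simp_all
  by_cases h1 : i = j ∧ k = l
  · obtain ⟨rfl, rfl⟩ := h1
    simp only [if_true, hfac]
    by_cases h : i = k
    · subst h; norm_num
    · simp [h]
  by_cases h2 : i = l ∧ k = j
  · obtain ⟨rfl, rfl⟩ := h2
    simp only [add_comm (if _ = k then 1 else 0) (if _ = i then 1 else 0), if_true, hfac]
    have h : i ≠ k := fun h => h1 ⟨h, h.symm⟩
    simp [h]
  rw [if_neg h1, if_neg h2, add_zero]
  have hex : ∃ x, (if x = i then 1 else 0) + (if x = k then 1 else 0)
      ≠ (if x = j then 1 else 0) + (if x = l then 1 else 0) := by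
    by_cases hij : i = j
    · refine ⟨l, ?_⟩
      subst hij
      have : l ≠ k := fun h => h1 ⟨rfl, h.symm⟩
      simp [this]
    · by_cases hil : i = l
      · refine ⟨j, ?_⟩
        subst hil
        have : j ≠ k := fun h => h2 ⟨rfl, h.symm⟩
        simp [this, Ne.symm hij]
      · exact ⟨i, by simp [hij, hil]⟩
  obtain ⟨x, hx⟩ := hex
  exact Finset.prod_eq_zero (Finset.mem_univ x) (if_neg hx)

end Moments

section QuadraticForms

variable {ι κ : Type} [Fintype ι] [Fintype κ]

theorem star_dotProduct_mulVec_eq_sum (T : Matrix ι ι ℂ) (c : ι → ℂ) :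
    star c ⬝ᵥ (T *ᵥ c) = ∑ a, ∑ b, T a b * (star (c a) * c b) := by
  simp only [dotProduct, mulVec, Pi.star_apply, Finset.mul_sum]
  exact Finset.sum_congr rfl fun a _ => Finset.sum_congr rfl fun b _ => by ring

theorem sandwich_apply_eq_sum (K : Matrix ι ι ℂ) (M : Matrix κ κ ℂ) (D : Matrix ι κ ℂ)
    (a b : ι) :
    (Kᴴ * D * M * Dᴴ * K) a b
      = ∑ i', ∑ l', ∑ l, ∑ i, star (K i a) * M l l' * K i' b * (D i l * star (D i' l')) := by
  simp only [mul_apply, conjTranspose_apply, Finset.sum_mul]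
  exact Finset.sum_congr rfl fun _ _ => Finset.sum_congr rfl fun _ _ =>
    Finset.sum_congr rfl fun _ _ => Finset.sum_congr rfl fun _ _ => by ring

theorem integrable_sandwich (K : Matrix ι ι ℂ) (M : Matrix κ κ ℂ) (a b : ι) :
    Integrable (fun D : ι → κ → ℂ => (Kᴴ * of D * M * (of D)ᴴ * K) a b) (stdCGaussMat ι κ) := by
  classical
  simp_rw [sandwich_apply_eq_sum, of_apply]
  exact integrable_finsetSum _ fun _ _ => integrable_finsetSum _ fun _ _ =>
    integrable_finsetSum _ fun _ _ => integrable_finsetSum _ fun _ _ =>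
      (integrable_mul_star _ _ _ _).const_mul _

/-- For a standard complex Gaussian matrix, `E[D M Dᴴ] = tr(M) I`. -/
theorem integral_sandwich (K : Matrix ι ι ℂ) (M : Matrix κ κ ℂ) (a b : ι) :
    ∫ D : ι → κ → ℂ, (Kᴴ * of D * M * (of D)ᴴ * K) a b ∂(stdCGaussMat ι κ)
      = M.trace * (Kᴴ * K) a b := by
  classical
  have hi := integrable_mul_star (ι := ι) (κ := κ)
  simp_rw [sandwich_apply_eq_sum, of_apply]
  rw [integral_finsetSum _ fun _ _ => integrable_finsetSum _ fun _ _ =>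
    integrable_finsetSum _ fun _ _ => integrable_finsetSum _ fun _ _ => (hi _ _ _ _).const_mul _]
  simp_rw [integral_finsetSum _ fun _ _ => integrable_finsetSum _ fun _ _ =>
    integrable_finsetSum _ fun _ _ => (hi _ _ _ _).const_mul _]
  simp_rw [integral_finsetSum _ fun _ _ => integrable_finsetSum _ fun _ _ =>
    (hi _ _ _ _).const_mul _]
  simp_rw [integral_finsetSum _ fun _ _ => (hi _ _ _ _).const_mul _]
  simp_rw [integral_const_mul, integral_mul_star, ite_and, mul_ite, mul_one, mul_zero,
    Finset.sum_ite_eq', Finset.mem_univ, if_true]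
  simp only [Finset.sum_ite_eq', Finset.mem_univ, if_true, trace, diag_apply, mul_apply,
    conjTranspose_apply, Finset.sum_mul, Finset.mul_sum]
  exact Finset.sum_congr rfl fun _ _ => Finset.sum_congr rfl fun _ _ => by ring

theorem integral_mul_quadratic_forms {X Y : Type} [MeasurableSpace X] [MeasurableSpace Y]
    (μ : Measure X) (ν : Measure Y) [SFinite μ] [SFinite ν]
    (S : X → Matrix ι ι ℂ) (T : Y → Matrix ι ι ℂ)
    (hS : ∀ a b, Integrable (fun x => S x a b) μ) (hT : ∀ a b, Integrable (fun y => T y a b) ν)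
    (s t : ℂ) (P Q : Matrix ι ι ℂ) (hSP : ∀ a b, ∫ x, S x a b ∂μ = s * P a b)
    (hTQ : ∀ a b, ∫ y, T y a b ∂ν = t * Q a b) :
    ∫ p : X × Y × (ι → ℂ), (star p.2.2 ⬝ᵥ (S p.1 *ᵥ p.2.2)) * (star p.2.2 ⬝ᵥ (T p.2.1 *ᵥ p.2.2))
        ∂(μ.prod (ν.prod (stdCGaussPi ι)))
      = s * t * (P.trace * Q.trace + (P * Q).trace) := by
  classical
  have hint (a b a' b' : ι) : Integrable (fun p : X × Y × (ι → ℂ) => S p.1 a b * (T p.2.1 a' b' *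
      (star (p.2.2 a) * p.2.2 b * (star (p.2.2 a') * p.2.2 b'))))
      (μ.prod (ν.prod (stdCGaussPi ι))) :=
    (hS a b).mul_prod ((hT a' b').mul_prod (integrable_star_mul_mul_star_mul a b a' b'))
  have hval (a b a' b' : ι) : ∫ p : X × Y × (ι → ℂ), S p.1 a b * (T p.2.1 a' b' *
      (star (p.2.2 a) * p.2.2 b * (star (p.2.2 a') * p.2.2 b')))
      ∂(μ.prod (ν.prod (stdCGaussPi ι)))
      = s * P a b * (t * Q a' b' *
        ((if a = b ∧ a' = b' then 1 else 0) + (if a = b' ∧ a' = b then 1 else 0))) := by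
    rw [← hSP, ← hTQ, ← integral_star_mul_mul_star_mul,
      ← integral_prod_mul (fun y => T y a' b'), ← integral_prod_mul (fun x => S x a b)]
  have hexp (p : X × Y × (ι → ℂ)) :
      (star p.2.2 ⬝ᵥ (S p.1 *ᵥ p.2.2)) * (star p.2.2 ⬝ᵥ (T p.2.1 *ᵥ p.2.2))
        = ∑ a, ∑ b, ∑ a', ∑ b', S p.1 a b * (T p.2.1 a' b' *
          (star (p.2.2 a) * p.2.2 b * (star (p.2.2 a') * p.2.2 b'))) := by
    simp_rw [star_dotProduct_mulVec_eq_sum, Finset.sum_mul, Finset.mul_sum]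
    exact Finset.sum_congr rfl fun _ _ => Finset.sum_congr rfl fun _ _ =>
      Finset.sum_congr rfl fun _ _ => Finset.sum_congr rfl fun _ _ => by ring
  simp_rw [hexp]
  rw [integral_finsetSum _ fun _ _ => integrable_finsetSum _ fun _ _ =>
    integrable_finsetSum _ fun _ _ => integrable_finsetSum _ fun _ _ => hint _ _ _ _]
  simp_rw [integral_finsetSum _ fun _ _ => integrable_finsetSum _ fun _ _ =>
    integrable_finsetSum _ fun _ _ => hint _ _ _ _]
  simp_rw [integral_finsetSum _ fun _ _ => integrable_finsetSum _ fun _ _ => hint _ _ _ _]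
  simp_rw [integral_finsetSum _ fun _ _ => hint _ _ _ _, hval]
  have h1 : ∑ a, ∑ b, ∑ a', ∑ b', s * P a b * (t * Q a' b' * (if a = b ∧ a' = b' then 1 else 0))
      = s * t * (P.trace * Q.trace) := by
    simp only [ite_and, mul_ite, mul_one, mul_zero, Finset.sum_ite_eq, Finset.sum_ite_irrel,
      Finset.sum_const_zero, Finset.mem_univ, if_true, trace, diag_apply, Finset.sum_mul_sum]
    simp only [Finset.mul_sum]
    exact Finset.sum_congr rfl fun _ _ => Finset.sum_congr rfl fun _ _ => by ring
  have h2 : ∑ a, ∑ b, ∑ a', ∑ b', s * P a b * (t * Q a' b' * (if a = b' ∧ a' = b then 1 else 0))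
      = s * t * (P * Q).trace := by
    simp only [ite_and, mul_ite, mul_one, mul_zero, Finset.sum_ite_eq, Finset.sum_ite_eq',
      Finset.mem_univ, if_true, trace, diag_apply, mul_apply]
    simp only [Finset.mul_sum]
    exact Finset.sum_congr rfl fun _ _ => Finset.sum_congr rfl fun _ _ => by ring
  rw [mul_add, ← h1, ← h2]
  simp only [mul_add, Finset.sum_add_distrib]

end QuadraticForms

theorem hChan_quadratic_form {N L : ℕ} {βm βu : ℝ} (SRISm : Matrix (Fin N) (Fin N) ℂ)
    {SAP : Matrix (Fin L) (Fin L) ℂ} (hSAP : SAP.IsHermitian)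
    (hSRISm : SRISm.IsHermitian) (Φ SRISu : Matrix (Fin N) (Fin N) ℂ) (D : Fin N → Fin L → ℂ)
    (c : Fin N → ℂ) (A : Matrix (Fin L) (Fin L) ℂ) :
    star (hChan βm SRISm SAP Φ βu SRISu D c) ⬝ᵥ (A *ᵥ hChan βm SRISm SAP Φ βu SRISu D c)
      = star c ⬝ᵥ (((((Real.sqrt βm * Real.sqrt βu : ℝ) : ℂ) • (SRISm * Φ * SRISu))ᴴ * of D
        * (SAP * A * SAP) * (of D)ᴴ
        * (((Real.sqrt βm * Real.sqrt βu : ℝ) : ℂ) • (SRISm * Φ * SRISu))) *ᵥ c) := by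
  have h : hChan βm SRISm SAP Φ βu SRISu D c
      = (SAP * (of D)ᴴ * (((Real.sqrt βm * Real.sqrt βu : ℝ) : ℂ) • (SRISm * Φ * SRISu))) *ᵥ c := by
    simp only [hChan, Wmat, qVec, conjTranspose_smul, conjTranspose_mul, hSAP.eq, hSRISm.eq,
      mulVec_smul, smul_mulVec, mulVec_mulVec, Matrix.mul_smul, Matrix.smul_mul, Complex.star_def,
      Complex.conj_ofReal, Complex.ofReal_mul, Matrix.mul_assoc]
    rw [smul_smul, mul_comm]
  rw [h, star_mulVec, ← dotProduct_mulVec, mulVec_mulVec, mulVec_mulVec]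
  simp only [conjTranspose_mul, conjTranspose_conjTranspose, hSAP.eq, Matrix.mul_assoc]

theorem conjTranspose_mul_self_eq {N : ℕ} {βm βu : ℝ} (hβm : 0 ≤ βm) (hβu : 0 ≤ βu)
    {S Φ T : Matrix (Fin N) (Fin N) ℂ} (hS : S.IsHermitian) (hT : T.IsHermitian) :
    (((Real.sqrt βm * Real.sqrt βu : ℝ) : ℂ) • (S * Φ * T))ᴴ
        * (((Real.sqrt βm * Real.sqrt βu : ℝ) : ℂ) • (S * Φ * T))
      = ((βm * βu : ℝ) : ℂ) • (T * (Φᴴ * (S * S) * Φ * T)) := by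
  have h : (Real.sqrt βm * Real.sqrt βu) * (Real.sqrt βm * Real.sqrt βu) = βm * βu := by
    rw [mul_mul_mul_comm, Real.mul_self_sqrt hβm, Real.mul_self_sqrt hβu]
  rw [conjTranspose_smul, Complex.star_def, Complex.conj_ofReal, Matrix.smul_mul, Matrix.mul_smul,
    smul_smul, ← Complex.ofReal_mul, h]
  simp only [conjTranspose_mul, hS.eq, hT.eq, Matrix.mul_assoc]

/-- Two APs `m ≠ n` with independent fading and a common UE channel:
`E[(h_mkᴴ A h_mk)(h_nkᴴ B h_nk)]
  = tr(R_AP,m A) tr(R_AP,n B) (tr R̃_mk tr R̃_nk + tr(R̃_mk R̃_nk))`. -/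
theorem cross_AP_quadratic_forms
    {Ω : Type} [MeasurableSpace Ω] (μ : Measure Ω) [IsProbabilityMeasure μ]
    (N L : ℕ) (βm βn βk : ℝ) (hβm : 0 < βm) (hβn : 0 < βn) (hβk : 0 < βk)
    (SRISm RRISm SRISn RRISn : Matrix (Fin N) (Fin N) ℂ)
    (hSRISm : SRISm.PosSemidef) (hRRISm : SRISm * SRISm = RRISm)
    (hSRISn : SRISn.PosSemidef) (hRRISn : SRISn * SRISn = RRISn)
    (SRISk RRISk : Matrix (Fin N) (Fin N) ℂ)
    (hSRISk : SRISk.PosSemidef) (hRRISk : SRISk * SRISk = RRISk)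
    (SAPm RAPm SAPn RAPn : Matrix (Fin L) (Fin L) ℂ)
    (hSAPm : SAPm.PosSemidef) (hRAPm : SAPm * SAPm = RAPm)
    (hSAPn : SAPn.PosSemidef) (hRAPn : SAPn * SAPn = RAPn)
    (Φ : Matrix (Fin N) (Fin N) ℂ)
    (Dm Dn : Ω → Fin N → Fin L → ℂ) (c : Ω → Fin N → ℂ)
    (hDm : Measurable Dm) (hDn : Measurable Dn) (hc : Measurable c)
    (hlaw : μ.map (fun ω => (Dm ω, Dn ω, c ω))
      = (stdCGaussMat (Fin N) (Fin L)).prod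
          ((stdCGaussMat (Fin N) (Fin L)).prod (stdCGaussPi (Fin N))))
    (A B : Matrix (Fin L) (Fin L) ℂ) :
    (∫ ω,
        (star (hChan βm SRISm SAPm Φ βk SRISk (Dm ω) (c ω)) ⬝ᵥ
          (A *ᵥ hChan βm SRISm SAPm Φ βk SRISk (Dm ω) (c ω))) *
        (star (hChan βn SRISn SAPn Φ βk SRISk (Dn ω) (c ω)) ⬝ᵥ
          (B *ᵥ hChan βn SRISn SAPn Φ βk SRISk (Dn ω) (c ω))) ∂μ)
      = (RAPm * A).trace * (RAPn * B).trace *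
          ((Rtil βm βk RRISm Φ RRISk).trace * (Rtil βn βk RRISn Φ RRISk).trace
            + (Rtil βm βk RRISm Φ RRISk * Rtil βn βk RRISn Φ RRISk).trace) := by
  have hval := integral_mul_quadratic_forms _ _ _ _
    (integrable_sandwich (((Real.sqrt βm * Real.sqrt βk : ℝ) : ℂ) • (SRISm * Φ * SRISk))
      (SAPm * A * SAPm))
    (integrable_sandwich (((Real.sqrt βn * Real.sqrt βk : ℝ) : ℂ) • (SRISn * Φ * SRISk))
      (SAPn * B * SAPn)) _ _ _ _ (integral_sandwich _ _) (integral_sandwich _ _)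
  simp_rw [hChan_quadratic_form _ hSAPm.isHermitian hSRISm.isHermitian,
    hChan_quadratic_form _ hSAPn.isHermitian hSRISn.isHermitian]
  rw [← hlaw, integral_map (by fun_prop) ?meas] at hval
  case meas =>
    refine Measurable.aestronglyMeasurable ?_
    simp_rw [star_dotProduct_mulVec_eq_sum, sandwich_apply_eq_sum, of_apply]
    fun_prop
  rw [hval, conjTranspose_mul_self_eq hβm.le hβk.le hSRISm.isHermitian hSRISk.isHermitian,
    conjTranspose_mul_self_eq hβn.le hβk.le hSRISn.isHermitian hSRISk.isHermitian,
    hRRISm, hRRISn, Matrix.mul_assoc SAPm, trace_mul_comm SAPm, Matrix.mul_assoc A, hRAPm,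
    trace_mul_comm A, Matrix.mul_assoc SAPn, trace_mul_comm SAPn, Matrix.mul_assoc B, hRAPn,
    trace_mul_comm B]
  have htr (R : Matrix (Fin N) (Fin N) ℂ) :
      (SRISk * (Φᴴ * R * Φ * SRISk)).trace = (R * Φ * RRISk * Φᴴ).trace := by
    rw [trace_mul_comm, Matrix.mul_assoc _ SRISk, hRRISk, trace_mul_comm (R * Φ * RRISk)]
    simp only [Matrix.mul_assoc]
  have hprod : (SRISk * (Φᴴ * RRISm * Φ * SRISk) * (SRISk * (Φᴴ * RRISn * Φ * SRISk))).trace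
      = (RRISm * Φ * RRISk * Φᴴ * (RRISn * Φ * RRISk * Φᴴ)).trace := by
    have h := htr (RRISm * Φ * RRISk * Φᴴ * RRISn)
    rw [← hRRISk] at h ⊢
    simp only [Matrix.mul_assoc] at h ⊢
    exact h
  simp only [Rtil, trace_smul, Matrix.smul_mul, Matrix.mul_smul, htr, hprod]
end

section
/- In the correlated Rayleigh cascaded-channel model with two APs m ≠ n (independent D_m, D_n) and two UEs k ≠ l (independent q_k, q_l, both independent of D_m, D_n), for all deterministic matrices A, B ∈ ℂ^{L×L}: E[ h_mk^H A h_ml · h_nl^H B h_nk ] = tr(R_AP,m A) · tr(R_AP,n B) · tr(R̃_ml R̃_nk). -/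
open MeasureTheory ProbabilityTheory Matrix
open scoped ComplexOrder

/-- The random matrix `X` has integrable entries and entrywise expectation `M`. -/
def HasMatExp {Ω n m : Type} [MeasurableSpace Ω] (μ : Measure Ω)
    (X : Ω → Matrix n m ℂ) (M : Matrix n m ℂ) : Prop :=
  ∀ i j, Integrable (fun ω => X ω i j) μ ∧ ∫ ω, X ω i j ∂μ = M i j

namespace HasMatExp

variable {α β n m p : Type} [MeasurableSpace α] [MeasurableSpace β]
  {μ : Measure α} {ν : Measure β}

theorem comp_measurePreserving {f : α → β} (hf : MeasurePreserving f μ ν)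
    {X : β → Matrix n m ℂ} {M : Matrix n m ℂ} (hX : HasMatExp ν X M) :
    HasMatExp μ (fun a => X (f a)) M := by
  intro i j
  obtain ⟨hi, he⟩ := hX i j
  refine ⟨hf.integrable_comp_of_integrable hi, ?_⟩
  rw [← he, ← hf.map_eq, integral_map hf.aemeasurable (hf.map_eq ▸ hi.aestronglyMeasurable)]

theorem const_mul [Fintype n] (C : Matrix p n ℂ) {X : α → Matrix n m ℂ} {M : Matrix n m ℂ}
    (hX : HasMatExp μ X M) : HasMatExp μ (fun a => C * X a) (C * M) := by
  intro i j
  simp only [Matrix.mul_apply]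
  have hi : ∀ k ∈ Finset.univ, Integrable (fun a => C i k * X a k j) μ :=
    fun k _ => (hX k j).1.const_mul _
  refine ⟨integrable_finsetSum _ hi, ?_⟩
  rw [integral_finsetSum _ hi]
  simp_rw [integral_const_mul, fun k => (hX k j).2]

theorem mul_const [Fintype m] {X : α → Matrix n m ℂ} {M : Matrix n m ℂ}
    (hX : HasMatExp μ X M) (C : Matrix m p ℂ) : HasMatExp μ (fun a => X a * C) (M * C) := by
  intro i j
  simp only [Matrix.mul_apply]
  have hi : ∀ k ∈ Finset.univ, Integrable (fun a => X a i k * C k j) μ :=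
    fun k _ => (hX i k).1.mul_const _
  refine ⟨integrable_finsetSum _ hi, ?_⟩
  rw [integral_finsetSum _ hi]
  simp_rw [integral_mul_const, fun k => (hX i k).2]

theorem const_smul (c : ℂ) {X : α → Matrix n m ℂ} {M : Matrix n m ℂ}
    (hX : HasMatExp μ X M) : HasMatExp μ (fun a => c • X a) (c • M) := by
  intro i j
  simp only [Matrix.smul_apply, smul_eq_mul]
  exact ⟨(hX i j).1.const_mul _, by rw [integral_const_mul, (hX i j).2]⟩

theorem mul_prod [SFinite μ] [SFinite ν] [Fintype m]
    {X : α → Matrix n m ℂ} {M : Matrix n m ℂ} {Y : β → Matrix m p ℂ} {M' : Matrix m p ℂ}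
    (hX : HasMatExp μ X M) (hY : HasMatExp ν Y M') :
    HasMatExp (μ.prod ν) (fun a => X a.1 * Y a.2) (M * M') := by
  intro i j
  simp only [Matrix.mul_apply]
  have hi : ∀ k ∈ Finset.univ, Integrable (fun a : α × β => X a.1 i k * Y a.2 k j) (μ.prod ν) :=
    fun k _ => (hX i k).1.mul_prod (hY k j).1
  refine ⟨integrable_finsetSum _ hi, ?_⟩
  rw [integral_finsetSum _ hi]
  refine Finset.sum_congr rfl fun k _ => ?_
  rw [integral_prod_mul (fun a => X a i k) (fun b => Y b k j), (hX i k).2, (hY k j).2]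

theorem integral_trace [Fintype n] {X : α → Matrix n n ℂ} {M : Matrix n n ℂ}
    (hX : HasMatExp μ X M) : ∫ a, (X a).trace ∂μ = M.trace := by
  simp only [Matrix.trace, Matrix.diag_apply]
  rw [integral_finsetSum _ fun k _ => (hX k k).1]
  simp_rw [fun k => (hX k k).2]

end HasMatExp

section PiMoments

variable {ι E : Type} [Fintype ι] [MeasurableSpace E] {ν : Measure E} [IsProbabilityMeasure ν]
  {f g : E → ℂ}

theorem integrable_pi_eval (hf : Integrable f ν) (i : ι) :
    Integrable (fun x : ι → E => f (x i)) (Measure.pi fun _ => ν) :=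
  (measurePreserving_eval (fun _ : ι => ν) i).integrable_comp_of_integrable hf

theorem integral_pi_eval (hf : Integrable f ν) (i : ι) :
    ∫ x : ι → E, f (x i) ∂(Measure.pi fun _ => ν) = ∫ y, f y ∂ν := by
  have h := measurePreserving_eval (fun _ : ι => ν) i
  conv_rhs => rw [← h.map_eq]
  exact (integral_map h.aemeasurable (h.map_eq.symm ▸ hf.aestronglyMeasurable)).symm

theorem indepFun_pi_eval (hf : Measurable f) (hg : Measurable g) {i j : ι} (hij : i ≠ j) :
    IndepFun (fun x : ι → E => f (x i)) (fun x => g (x j)) (Measure.pi fun _ => ν) :=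
  ((iIndepFun_pi (μ := fun _ : ι => ν) (X := fun _ => id)
    fun _ => aemeasurable_id).indepFun hij).comp hf hg

theorem integrable_pi_eval_mul_eval (hfm : Measurable f) (hgm : Measurable g)
    (hf : Integrable f ν) (hg : Integrable g ν) {i j : ι} (hij : i ≠ j) :
    Integrable (fun x : ι → E => f (x i) * g (x j)) (Measure.pi fun _ => ν) :=
  (indepFun_pi_eval hfm hgm hij).integrable_mul (integrable_pi_eval hf i) (integrable_pi_eval hg j)

theorem integral_pi_eval_mul_eval (hfm : Measurable f) (hgm : Measurable g)
    (hf : Integrable f ν) (hg : Integrable g ν) {i j : ι} (hij : i ≠ j) :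
    ∫ x : ι → E, f (x i) * g (x j) ∂(Measure.pi fun _ => ν) = (∫ y, f y ∂ν) * ∫ y, g y ∂ν := by
  rw [(indepFun_pi_eval hfm hgm hij).integral_fun_mul_eq_mul_integral
    (integrable_pi_eval hf i).aestronglyMeasurable (integrable_pi_eval hg j).aestronglyMeasurable,
    integral_pi_eval hf, integral_pi_eval hg]

end PiMoments

theorem memLp_id_stdCGauss : MemLp (fun z : ℂ => z) 2 stdCGauss := by
  have h1 : MemLp (fun p : ℝ × ℝ => (p.1 : ℂ)) 2 ((gaussianReal 0 1).prod (gaussianReal 0 1)) :=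
    ((memLp_id_gaussianReal 2).ofReal (K := ℂ)).comp_fst _
  have h2 : MemLp (fun p : ℝ × ℝ => (p.2 : ℂ)) 2 ((gaussianReal 0 1).prod (gaussianReal 0 1)) :=
    ((memLp_id_gaussianReal 2).ofReal (K := ℂ)).comp_snd _
  refine (memLp_map_measure_iff (by fun_prop) (by fun_prop)).2 ?_
  have h3 := (h1.add (h2.mul_const Complex.I)).mul_const ((Real.sqrt 2 : ℂ)⁻¹)
  exact h3

theorem integrable_id_stdCGauss : Integrable (fun z : ℂ => z) stdCGauss :=
  memLp_id_stdCGauss.integrable (by norm_num)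

theorem integral_id_stdCGauss : ∫ z, z ∂stdCGauss = 0 := by
  have h0 : Integrable (fun x : ℝ => (x : ℂ)) (gaussianReal 0 1) :=
    (((memLp_id_gaussianReal 2).ofReal (K := ℂ)).integrable (by norm_num))
  have e0 : ∫ x : ℝ, (x : ℂ) ∂(gaussianReal 0 1) = 0 := by
    rw [integral_complex_ofReal, integral_id_gaussianReal]; simp
  have e1 : ∫ p : ℝ × ℝ, (p.1 : ℂ) ∂((gaussianReal 0 1).prod (gaussianReal 0 1)) = 0 := by
    rw [integral_fun_fst (fun x : ℝ => (x : ℂ)), e0, smul_zero]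
  have e2 : ∫ p : ℝ × ℝ, (p.2 : ℂ) ∂((gaussianReal 0 1).prod (gaussianReal 0 1)) = 0 := by
    rw [integral_fun_snd (fun x : ℝ => (x : ℂ)), e0, smul_zero]
  unfold stdCGauss
  rw [integral_map (by fun_prop) (by fun_prop), integral_div,
    integral_add (h0.comp_fst _) ((h0.comp_snd _).mul_const _), integral_mul_const, e1, e2]
  simp

theorem integrable_mul_star_stdCGauss : Integrable (fun z : ℂ => z * star z) stdCGauss :=
  memLp_id_stdCGauss.integrable_mul memLp_id_stdCGauss.star

theorem integral_mul_star_stdCGauss : ∫ z, z * star z ∂stdCGauss = 1 := by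
  have h0 : Integrable (fun x : ℝ => x ^ 2) (gaussianReal 0 1) :=
    (memLp_id_gaussianReal 2).integrable_sq
  have e0 : ∫ x : ℝ, x ^ 2 ∂(gaussianReal 0 1) = 1 := by
    have := variance_id_gaussianReal (μ := 0) (v := 1)
    rw [variance_eq_integral (by fun_prop)] at this
    simpa using this
  have key : ∀ p : ℝ × ℝ,
      ((p.1 : ℂ) + (p.2 : ℂ) * Complex.I) / (Real.sqrt 2 : ℂ) *
        star (((p.1 : ℂ) + (p.2 : ℂ) * Complex.I) / (Real.sqrt 2 : ℂ))
      = (((p.1 ^ 2 + p.2 ^ 2) / 2 : ℝ) : ℂ) := by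
    intro p
    have h2 : (Real.sqrt 2 : ℂ) * (Real.sqrt 2 : ℂ) = 2 := by
      rw [← Complex.ofReal_mul, Real.mul_self_sqrt (by norm_num)]; norm_num
    simp only [RCLike.star_def, map_div₀, map_add, map_mul, Complex.conj_ofReal, Complex.conj_I]
    rw [div_mul_div_comm, h2]
    push_cast
    linear_combination (-(p.2 : ℂ) ^ 2 / 2) * Complex.I_sq
  unfold stdCGauss
  rw [integral_map (by fun_prop) (by fun_prop)]
  simp_rw [key]
  rw [integral_complex_ofReal, integral_div, integral_add (h0.comp_fst _) (h0.comp_snd _),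
    integral_fun_fst (fun x : ℝ => x ^ 2), integral_fun_snd (fun x : ℝ => x ^ 2), e0]
  norm_num

section

variable {ι κ : Type} [Fintype ι] [Fintype κ] [DecidableEq ι] [DecidableEq κ]

theorem integral_star_stdCGauss : ∫ z, star z ∂stdCGauss = 0 := by
  have h : ∫ z, (starRingEnd ℂ) z ∂stdCGauss = 0 := by
    rw [integral_conj, integral_id_stdCGauss, map_zero]
  exact h

theorem integrable_star_stdCGauss : Integrable (fun z : ℂ => star z) stdCGauss :=
  memLp_id_stdCGauss.star.integrable (by norm_num)

theorem integrable_mul_star_stdCGaussPi (i j : ι) :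
    Integrable (fun c : ι → ℂ => c i * star (c j)) (stdCGaussPi ι) := by
  by_cases hij : i = j
  · subst hij
    exact integrable_pi_eval integrable_mul_star_stdCGauss i
  · exact integrable_pi_eval_mul_eval measurable_id continuous_star.measurable
      integrable_id_stdCGauss integrable_star_stdCGauss hij

theorem integral_mul_star_stdCGaussPi (i j : ι) :
    ∫ c : ι → ℂ, c i * star (c j) ∂(stdCGaussPi ι) = if i = j then 1 else 0 := by
  split_ifs with hij
  · subst hij
    exact (integral_pi_eval integrable_mul_star_stdCGauss i).trans integral_mul_star_stdCGauss
  · refine (integral_pi_eval_mul_eval measurable_id continuous_star.measurable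
      integrable_id_stdCGauss integrable_star_stdCGauss hij).trans ?_
    rw [integral_star_stdCGauss, mul_zero]

theorem integrable_mul_star_stdCGaussMat (i j : ι) (a b : κ) :
    Integrable (fun D : ι → κ → ℂ => D i a * star (D j b)) (stdCGaussMat ι κ) := by
  by_cases hij : i = j
  · subst hij
    exact integrable_pi_eval (integrable_mul_star_stdCGaussPi a b) i
  · exact integrable_pi_eval_mul_eval (f := fun c : κ → ℂ => c a) (g := fun c => star (c b))
      (by fun_prop) (continuous_star.measurable.comp (measurable_pi_apply b))
      (integrable_pi_eval integrable_id_stdCGauss a)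
      (integrable_pi_eval integrable_star_stdCGauss b) hij

theorem integral_mul_star_stdCGaussMat (i j : ι) (a b : κ) :
    ∫ D : ι → κ → ℂ, D i a * star (D j b) ∂(stdCGaussMat ι κ)
      = if i = j then if a = b then 1 else 0 else 0 := by
  by_cases hij : i = j
  · subst hij
    rw [if_pos rfl, ← integral_mul_star_stdCGaussPi]
    exact integral_pi_eval (integrable_mul_star_stdCGaussPi a b) i
  · rw [if_neg hij]
    refine (integral_pi_eval_mul_eval (f := fun c : κ → ℂ => c a) (g := fun c => star (c b))
      (by fun_prop) (continuous_star.measurable.comp (measurable_pi_apply b))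
      (integrable_pi_eval integrable_id_stdCGauss a)
      (integrable_pi_eval integrable_star_stdCGauss b) hij).trans ?_
    have h := integral_pi_eval (ι := κ) integrable_star_stdCGauss b
    rw [integral_star_stdCGauss] at h
    exact mul_eq_zero_of_right _ h

theorem hasMatExp_vecMulVec_stdCGaussPi :
    HasMatExp (stdCGaussPi ι) (fun c => vecMulVec c (star c)) 1 := by
  intro i j
  refine ⟨integrable_mul_star_stdCGaussPi i j, ?_⟩
  rw [Matrix.one_apply]
  exact integral_mul_star_stdCGaussPi i j

theorem hasMatExp_mul_conjTranspose_stdCGaussMat (M : Matrix κ κ ℂ) :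
    HasMatExp (stdCGaussMat ι κ) (fun D => of D * M * (of D)ᴴ) (M.trace • 1) := by
  intro i j
  have h : ∀ D : ι → κ → ℂ, (of D * M * (of D)ᴴ) i j
      = ∑ b, ∑ a, M a b * (D i a * star (D j b)) := by
    intro D
    simp only [Matrix.mul_apply, Finset.sum_mul, conjTranspose_apply, of_apply]
    exact Finset.sum_congr rfl fun b _ => Finset.sum_congr rfl fun a _ => by ring
  simp_rw [h]
  have hi : ∀ a b, Integrable (fun D : ι → κ → ℂ => M a b * (D i a * star (D j b)))
      (stdCGaussMat ι κ) := fun a b => (integrable_mul_star_stdCGaussMat i j a b).const_mul _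
  refine ⟨integrable_finsetSum _ fun b _ => integrable_finsetSum _ fun a _ => hi a b, ?_⟩
  rw [integral_finsetSum _ fun b _ => integrable_finsetSum _ fun a _ => hi a b]
  simp_rw [integral_finsetSum Finset.univ fun a _ => hi a _, integral_const_mul,
    integral_mul_star_stdCGaussMat]
  by_cases hij : i = j <;> simp [hij, Matrix.trace]

end

section

variable {N L : ℕ}

theorem hasMatExp_qVec {β : ℝ} (hβ : 0 ≤ β) {S : Matrix (Fin N) (Fin N) ℂ} (hS : S.IsHermitian) :
    HasMatExp (stdCGaussPi (Fin N))
      (fun c => vecMulVec (qVec β S c) (star (qVec β S c))) ((β : ℂ) • (S * S)) := by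
  have h := ((hasMatExp_vecMulVec_stdCGaussPi.const_mul S).mul_const S).const_smul (β : ℂ)
  rw [Matrix.mul_one] at h
  convert h using 2 with c
  have h2 : (Real.sqrt β : ℂ) * (Real.sqrt β : ℂ) = β := by
    rw [← Complex.ofReal_mul, Real.mul_self_sqrt hβ]
  rw [qVec, star_smul, vecMulVec_smul, smul_vecMulVec, star_mulVec, hS.eq, smul_smul,
    Matrix.mul_vecMulVec, Matrix.vecMulVec_mul, RCLike.star_def, Complex.conj_ofReal, h2]

theorem hasMatExp_Wmat {β : ℝ} (hβ : 0 ≤ β) {S : Matrix (Fin N) (Fin N) ℂ} (hS : S.IsHermitian)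
    {T : Matrix (Fin L) (Fin L) ℂ} (hT : T.IsHermitian) (A : Matrix (Fin L) (Fin L) ℂ) :
    HasMatExp (stdCGaussMat (Fin N) (Fin L))
      (fun D => Wmat β S T D * A * (Wmat β S T D)ᴴ)
      ((β : ℂ) • (T * T * A).trace • (S * S)) := by
  have h := (((hasMatExp_mul_conjTranspose_stdCGaussMat (ι := Fin N)
    (T * A * T)).const_mul S).mul_const S).const_smul (β : ℂ)
  rw [Matrix.mul_smul, Matrix.mul_one, Matrix.smul_mul, Matrix.trace_mul_comm,
    ← Matrix.mul_assoc] at h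
  convert h using 2 with D
  have h2 : (Real.sqrt β : ℂ) * (Real.sqrt β : ℂ) = β := by
    rw [← Complex.ofReal_mul, Real.mul_self_sqrt hβ]
  simp only [Wmat, conjTranspose_smul, conjTranspose_mul, hS.eq, hT.eq, Matrix.smul_mul,
    Matrix.mul_smul, smul_smul, RCLike.star_def, Complex.conj_ofReal, h2, Matrix.mul_assoc]

theorem star_hChan_dotProduct_mulVec {β βu βv : ℝ} {S : Matrix (Fin N) (Fin N) ℂ}
    {T : Matrix (Fin L) (Fin L) ℂ} (Φ Ψ U V : Matrix (Fin N) (Fin N) ℂ)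
    (A : Matrix (Fin L) (Fin L) ℂ) (D : Fin N → Fin L → ℂ) (c d : Fin N → ℂ) :
    star (hChan β S T Φ βu U D c) ⬝ᵥ (A *ᵥ hChan β S T Ψ βv V D d)
      = star (qVec βu U c) ⬝ᵥ
        ((Φᴴ * (Wmat β S T D * A * (Wmat β S T D)ᴴ) * Ψ) *ᵥ qVec βv V d) := by
  simp only [hChan, star_mulVec, conjTranspose_conjTranspose, dotProduct_mulVec, vecMul_vecMul,
    Matrix.mul_assoc]

/-- A product of two sesquilinear forms with crossed arguments is a trace. -/
theorem dotProduct_mulVec_mul_dotProduct_mulVec {n : Type} [Fintype n] (P Q : Matrix n n ℂ)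
    (x y : n → ℂ) :
    (star x ⬝ᵥ (P *ᵥ y)) * (star y ⬝ᵥ (Q *ᵥ x))
      = (P * (vecMulVec y (star y) * (Q * vecMulVec x (star x)))).trace := by
  rw [Matrix.mul_vecMulVec, Matrix.vecMulVec_mul_vecMulVec, Matrix.vecMulVec_smul,
    Matrix.mul_smul, Matrix.trace_smul, Matrix.mul_vecMulVec, Matrix.trace_vecMulVec, dotProduct_comm (P *ᵥ y), smul_eq_mul, mul_comm]

end

/-- Two APs `m ≠ n` and two UEs `k ≠ l`, all sources independent:
`E[h_mkᴴ A h_ml · h_nlᴴ B h_nk] = tr(R_AP,m A) tr(R_AP,n B) tr(R̃_ml R̃_nk)`. -/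
theorem cross_AP_cross_UE_quadratic_forms
    {Ω : Type} [MeasurableSpace Ω] (μ : Measure Ω) [IsProbabilityMeasure μ]
    (N L : ℕ) (βm βn βk βl : ℝ)
    (hβm : 0 < βm) (hβn : 0 < βn) (hβk : 0 < βk) (hβl : 0 < βl)
    (SRISm RRISm SRISn RRISn : Matrix (Fin N) (Fin N) ℂ)
    (hSRISm : SRISm.PosSemidef) (hRRISm : SRISm * SRISm = RRISm)
    (hSRISn : SRISn.PosSemidef) (hRRISn : SRISn * SRISn = RRISn)
    (SRISk RRISk SRISl RRISl : Matrix (Fin N) (Fin N) ℂ)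
    (hSRISk : SRISk.PosSemidef) (hRRISk : SRISk * SRISk = RRISk)
    (hSRISl : SRISl.PosSemidef) (hRRISl : SRISl * SRISl = RRISl)
    (SAPm RAPm SAPn RAPn : Matrix (Fin L) (Fin L) ℂ)
    (hSAPm : SAPm.PosSemidef) (hRAPm : SAPm * SAPm = RAPm)
    (hSAPn : SAPn.PosSemidef) (hRAPn : SAPn * SAPn = RAPn)
    (Φk Φl : Matrix (Fin N) (Fin N) ℂ)
    (Dm Dn : Ω → Fin N → Fin L → ℂ) (ck cl : Ω → Fin N → ℂ)
    (hDm : Measurable Dm) (hDn : Measurable Dn)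
    (hck : Measurable ck) (hcl : Measurable cl)
    (hlaw : μ.map (fun ω => (Dm ω, Dn ω, ck ω, cl ω))
      = (stdCGaussMat (Fin N) (Fin L)).prod
          ((stdCGaussMat (Fin N) (Fin L)).prod
            ((stdCGaussPi (Fin N)).prod (stdCGaussPi (Fin N)))))
    (A B : Matrix (Fin L) (Fin L) ℂ) :
    (∫ ω,
        (star (hChan βm SRISm SAPm Φk βk SRISk (Dm ω) (ck ω)) ⬝ᵥ
          (A *ᵥ hChan βm SRISm SAPm Φl βl SRISl (Dm ω) (cl ω))) *
        (star (hChan βn SRISn SAPn Φl βl SRISl (Dn ω) (cl ω)) ⬝ᵥ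
          (B *ᵥ hChan βn SRISn SAPn Φk βk SRISk (Dn ω) (ck ω))) ∂μ)
      = (RAPm * A).trace * (RAPn * B).trace *
          (Rtil βm βl RRISm Φl RRISl * Rtil βn βk RRISn Φk RRISk).trace := by
  have hmp : MeasurePreserving (fun ω => (Dm ω, cl ω, Dn ω, ck ω)) μ
      ((stdCGaussMat (Fin N) (Fin L)).prod ((stdCGaussPi (Fin N)).prod
        ((stdCGaussMat (Fin N) (Fin L)).prod (stdCGaussPi (Fin N))))) := by
    have h0 : MeasurePreserving (fun ω => (Dm ω, Dn ω, ck ω, cl ω)) μ _ := ⟨by fun_prop, hlaw⟩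
    exact ((MeasurePreserving.id _).prod (Measure.measurePreserving_swap.comp
      ((measurePreserving_prodAssoc _ _ _).symm _))).comp h0
  have hP := hasMatExp_Wmat hβm.le hSRISm.1 hSAPm.1 A
  have hQ := hasMatExp_Wmat hβn.le hSRISn.1 hSAPn.1 B
  have hK := hasMatExp_qVec hβk.le hSRISk.1
  have hM := hasMatExp_qVec hβl.le hSRISl.1
  have hQK := ((hQ.const_mul Φlᴴ).mul_const Φk).mul_prod hK
  have hsf : SFinite ((stdCGaussPi (Fin N)).prod
      ((stdCGaussMat (Fin N) (Fin L)).prod (stdCGaussPi (Fin N)))) :=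
    Measure.prod.instSFinite
  have hMQK := hM.mul_prod hQK
  have h := ((((hP.const_mul Φkᴴ).mul_const Φl).mul_prod
    hMQK).comp_measurePreserving hmp).integral_trace
  simp only [star_hChan_dotProduct_mulVec, dotProduct_mulVec_mul_dotProduct_mulVec]
  refine h.trans ?_
  simp only [hRRISm, hRRISn, hRRISk, hRRISl, hRAPm, hRAPn, Rtil, Matrix.smul_mul, Matrix.mul_smul,
    Matrix.trace_smul, smul_eq_mul, Matrix.mul_assoc, Complex.ofReal_mul]
  rw [Matrix.trace_mul_comm Φkᴴ]
  simp only [Matrix.mul_assoc]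
  ring
end

section
/- In the uplink pilot model, the cross-covariance between the projected pilot observation and the cascaded channel of UE k satisfies E[y_mk · h_mk^H] = √(pτ) · R_mk. -/
open MeasureTheory ProbabilityTheory Matrix
open scoped ComplexOrder

open scoped ComplexConjugate

/-- A family of centred complex random variables, orthonormal in `L²`. -/
structure IsWhite {E ι : Type*} [MeasurableSpace E] (μ : Measure E) (X : ι → E → ℂ) : Prop where
  measurable : ∀ i, Measurable (X i)
  integrable : ∀ i, Integrable (X i) μ
  integral_eq_zero : ∀ i, ∫ x, X i x ∂μ = 0
  integrable_mul_conj : ∀ i j, Integrable (fun x => X i x * conj (X j x)) μ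
  integral_mul_conj_self : ∀ i, ∫ x, X i x * conj (X i x) ∂μ = 1
  integral_mul_conj_of_ne : ∀ i j, i ≠ j → ∫ x, X i x * conj (X j x) ∂μ = 0

lemma integrable_conj {E : Type*} [MeasurableSpace E] {μ : Measure E} {f : E → ℂ}
    (hf : Integrable f μ) : Integrable (fun x => conj (f x)) μ :=
  Complex.conjCLE.toContinuousLinearMap.integrable_comp hf

namespace IsWhite

variable {E F ι κ : Type*} [MeasurableSpace E] [MeasurableSpace F] {μ : Measure E} {ν : Measure F}

lemma comp_measurePreserving {X : ι → F → ℂ} (hX : IsWhite ν X) {T : E → F}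
    (hT : MeasurePreserving T μ ν) : IsWhite μ (fun i x => X i (T x)) := by
  have hint : ∀ f : F → ℂ, Measurable f → ∫ x, f (T x) ∂μ = ∫ y, f y ∂ν := fun f hf => by
    rw [← hT.map_eq, integral_map hT.measurable.aemeasurable hf.aestronglyMeasurable]
  have hm : ∀ i j, Measurable fun x => X i x * conj (X j x) := fun i j =>
    (hX.measurable i).mul (Complex.continuous_conj.measurable.comp (hX.measurable j))
  exact
    { measurable := fun i => (hX.measurable i).comp hT.measurable
      integrable := fun i => hT.integrable_comp_of_integrable (hX.integrable i)
      integral_eq_zero := fun i => (hint _ (hX.measurable i)).trans (hX.integral_eq_zero i)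
      integrable_mul_conj := fun i j => hT.integrable_comp_of_integrable (hX.integrable_mul_conj i j)
      integral_mul_conj_self := fun i => (hint _ (hm i i)).trans (hX.integral_mul_conj_self i)
      integral_mul_conj_of_ne := fun i j hij =>
        (hint _ (hm i j)).trans (hX.integral_mul_conj_of_ne i j hij) }

lemma comp_injective {X : ι → E → ℂ} (hX : IsWhite μ X) {f : κ → ι} (hf : f.Injective) :
    IsWhite μ (fun k => X (f k)) where
  measurable k := hX.measurable (f k)
  integrable k := hX.integrable (f k)
  integral_eq_zero k := hX.integral_eq_zero (f k)
  integrable_mul_conj k l := hX.integrable_mul_conj (f k) (f l)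
  integral_mul_conj_self k := hX.integral_mul_conj_self (f k)
  integral_mul_conj_of_ne _ _ hkl := hX.integral_mul_conj_of_ne _ _ (hf.ne hkl)

lemma pi [Fintype ι] [IsProbabilityMeasure ν] {X : κ → F → ℂ} (hX : IsWhite ν X) :
    IsWhite (Measure.pi fun _ : ι => ν) (fun (s : ι × κ) x => X s.2 (x s.1)) := by
  have hi : ∀ i : ι, IsWhite (Measure.pi fun _ : ι => ν) (fun a x => X a (x i)) := fun i =>
    hX.comp_measurePreserving (measurePreserving_eval (fun _ : ι => ν) i)
  have hindep : ∀ i j : ι, i ≠ j → ∀ a b,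
      (fun x : ι → F => X a (x i)) ⟂ᵢ[Measure.pi fun _ : ι => ν] fun x => conj (X b (x j)) :=
    fun i j hij a b =>
      ((iIndepFun_pi (μ := fun _ : ι => ν) (X := fun _ => id)
        fun _ => aemeasurable_id).indepFun hij).comp (hX.measurable a)
          (Complex.continuous_conj.measurable.comp (hX.measurable b))
  refine ⟨fun s => (hi s.1).measurable s.2, fun s => (hi s.1).integrable s.2,
    fun s => (hi s.1).integral_eq_zero s.2, ?_, fun s => (hi s.1).integral_mul_conj_self s.2, ?_⟩
  · rintro ⟨i, a⟩ ⟨j, b⟩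
    by_cases hij : i = j
    · subst hij
      exact (hi i).integrable_mul_conj a b
    · exact (hindep i j hij a b).integrable_mul ((hi i).integrable a)
        (integrable_conj ((hi j).integrable b))
  · rintro ⟨i, a⟩ ⟨j, b⟩ hne
    by_cases hij : i = j
    · subst hij
      exact (hi i).integral_mul_conj_of_ne a b fun h => hne (by rw [h])
    · have := (hindep i j hij a b).integral_fun_mul_eq_mul_integral
        ((hi i).integrable a).aestronglyMeasurable
        (integrable_conj ((hi j).integrable b)).aestronglyMeasurable
      exact this.trans (by rw [(hi i).integral_eq_zero a, zero_mul])

lemma conj_mul_prod [SFinite μ] [SFinite ν] {X : ι → E → ℂ} {Y : κ → F → ℂ}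
    (hX : IsWhite μ X) (hY : IsWhite ν Y) :
    IsWhite (μ.prod ν) (fun (s : ι × κ) x => conj (X s.1 x.1) * Y s.2 x.2) := by
  have key : ∀ s t : ι × κ, (fun x : E × F => conj (X s.1 x.1) * Y s.2 x.2 *
      conj (conj (X t.1 x.1) * Y t.2 x.2)) =
      fun x => (X t.1 x.1 * conj (X s.1 x.1)) * (Y s.2 x.2 * conj (Y t.2 x.2)) := by
    intro s t
    ext x
    simp only [map_mul, Complex.conj_conj]
    ring
  have hval : ∀ s t : ι × κ, ∫ x : E × F, conj (X s.1 x.1) * Y s.2 x.2 *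
      conj (conj (X t.1 x.1) * Y t.2 x.2) ∂μ.prod ν =
      (∫ x, X t.1 x * conj (X s.1 x) ∂μ) * ∫ y, Y s.2 y * conj (Y t.2 y) ∂ν := by
    intro s t
    rw [key, integral_prod_mul (fun x => X t.1 x * conj (X s.1 x))
      (fun y => Y s.2 y * conj (Y t.2 y))]
  constructor
  · intro s
    exact (Complex.continuous_conj.measurable.comp
      ((hX.measurable s.1).comp measurable_fst)).mul ((hY.measurable s.2).comp measurable_snd)
  · exact fun s => (integrable_conj (hX.integrable s.1)).mul_prod (hY.integrable s.2)
  · intro s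
    rw [integral_prod_mul (fun x => conj (X s.1 x)) (Y s.2), hY.integral_eq_zero, mul_zero]
  · intro s t
    rw [key]
    exact (hX.integrable_mul_conj t.1 s.1).mul_prod (hY.integrable_mul_conj s.2 t.2)
  · intro s
    rw [hval, hX.integral_mul_conj_self, hY.integral_mul_conj_self, one_mul]
  · rintro ⟨i, a⟩ ⟨j, b⟩ hne
    rw [hval]
    by_cases hij : i = j
    · rw [hY.integral_mul_conj_of_ne a b fun h => hne (by rw [hij, h]), mul_zero]
    · rw [hX.integral_mul_conj_of_ne j i (Ne.symm hij), zero_mul]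

lemma integrable_sum_mul_conj_sum {κ' : Type*} [Fintype κ] [Fintype κ'] {X : ι → E → ℂ}
    (hX : IsWhite μ X) (f : κ → ι) (g : κ' → ι) (a : κ → ℂ) (b : κ' → ℂ) :
    Integrable (fun x => (∑ s, a s * X (f s) x) * conj (∑ t, b t * X (g t) x)) μ := by
  simp only [map_sum, map_mul, Finset.sum_mul_sum]
  refine integrable_finsetSum _ fun s _ => integrable_finsetSum _ fun t _ => ?_
  exact ((hX.integrable_mul_conj (f s) (g t)).const_mul (a s * conj (b t))).congr
    (.of_forall fun x => by ring)

lemma integral_sum_mul_conj_sum {κ' : Type*} [Fintype κ] [Fintype κ'] {X : ι → E → ℂ}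
    (hX : IsWhite μ X) (f : κ → ι) (g : κ' → ι) (a : κ → ℂ) (b : κ' → ℂ) :
    ∫ x, (∑ s, a s * X (f s) x) * conj (∑ t, b t * X (g t) x) ∂μ =
      ∑ s, ∑ t, a s * conj (b t) * ∫ x, X (f s) x * conj (X (g t) x) ∂μ := by
  have hi : ∀ s t, Integrable
      (fun x => a s * X (f s) x * (conj (b t) * conj (X (g t) x))) μ := fun s t =>
    ((hX.integrable_mul_conj (f s) (g t)).const_mul (a s * conj (b t))).congr
      (.of_forall fun x => by ring)
  simp only [map_sum, map_mul, Finset.sum_mul_sum]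
  rw [integral_finsetSum _ fun s _ => integrable_finsetSum _ fun t _ => hi s t]
  refine Finset.sum_congr rfl fun s _ => ?_
  rw [integral_finsetSum _ fun t _ => hi s t]
  refine Finset.sum_congr rfl fun t _ => ?_
  rw [← integral_const_mul]
  exact integral_congr_ae (.of_forall fun x => by ring)

lemma integral_sum_mul_conj_sum_of_injective [Fintype κ] {X : ι → E → ℂ}
    (hX : IsWhite μ X) {f : κ → ι} (hf : f.Injective) (a b : κ → ℂ) :
    ∫ x, (∑ s, a s * X (f s) x) * conj (∑ t, b t * X (f t) x) ∂μ = ∑ s, a s * conj (b s) := by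
  rw [hX.integral_sum_mul_conj_sum]
  refine Finset.sum_congr rfl fun s _ => ?_
  rw [Finset.sum_eq_single s, hX.integral_mul_conj_self, mul_one]
  · intro t _ hts
    rw [hX.integral_mul_conj_of_ne _ _ (hf.ne hts.symm), mul_zero]
  · simp

end IsWhite

instance inst_s8 : IsProbabilityMeasure stdCGauss :=
  Measure.isProbabilityMeasure_map (by fun_prop)

instance inst_s8_2 (ι : Type) [Fintype ι] : IsProbabilityMeasure (stdCGaussPi ι) := by
  unfold stdCGaussPi; infer_instance

instance inst_s8_3 (ι κ : Type) [Fintype ι] [Fintype κ] : IsProbabilityMeasure (stdCGaussMat ι κ) := by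
  unfold stdCGaussMat; infer_instance

lemma isWhite_stdCGauss : IsWhite stdCGauss (fun (_ : Unit) x => x) := by
  set T : ℝ × ℝ → ℂ := fun p => ((p.1 : ℂ) + (p.2 : ℂ) * Complex.I) / (Real.sqrt 2 : ℂ) with hT
  have hTm : Measurable T := by fun_prop
  have h1 : Integrable (fun x : ℝ => x) (gaussianReal 0 1) :=
    (memLp_id_gaussianReal (μ := 0) (v := 1) 1).integrable le_rfl
  have h2 : Integrable (fun x : ℝ => x ^ 2) (gaussianReal 0 1) :=
    (memLp_id_gaussianReal (μ := 0) (v := 1) 2).integrable_sq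
  have hvar : ∫ x : ℝ, x ^ 2 ∂gaussianReal 0 1 = 1 := by
    have := variance_of_integral_eq_zero (μ := gaussianReal 0 1) (X := id) aemeasurable_id
      integral_id_gaussianReal
    rw [variance_id_gaussianReal] at this
    exact this.symm
  have hsq : ∀ p : ℝ × ℝ, T p * conj (T p) = (((p.1 ^ 2 + p.2 ^ 2) / 2 : ℝ) : ℂ) := by
    intro p
    have h : T p = (((p.1 / √2 : ℝ)) : ℂ) + ((p.2 / √2 : ℝ) : ℂ) * Complex.I := by
      simp only [hT]; push_cast; ring
    rw [Complex.mul_conj, h, Complex.normSq_add_mul_I]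
    congr 1
    rw [div_pow, div_pow, Real.sq_sqrt zero_le_two]
    ring
  have hmul : Measurable fun x : ℂ => x * conj x :=
    measurable_id.mul Complex.continuous_conj.measurable
  have hi1 : Integrable (fun x : ℝ => (x : ℂ)) (gaussianReal 0 1) := h1.ofReal
  have hi0 : ∫ x : ℝ, (x : ℂ) ∂gaussianReal 0 1 = 0 := by
    rw [integral_complex_ofReal, integral_id_gaussianReal, Complex.ofReal_zero]
  have hi : ∫ p, T p ∂(gaussianReal 0 1).prod (gaussianReal 0 1) = 0 := by
    simp only [hT]
    rw [integral_div, integral_add (hi1.comp_fst _) ((hi1.comp_snd _).mul_const Complex.I),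
      integral_mul_const, integral_fun_fst (fun x : ℝ => (x : ℂ)),
      integral_fun_snd (fun x : ℝ => (x : ℂ)), hi0]
    simp
  have hint2 : Integrable (fun p => T p * conj (T p))
      ((gaussianReal 0 1).prod (gaussianReal 0 1)) := by
    simp only [hsq]
    exact (((h2.comp_fst _).add (h2.comp_snd _)).div_const 2).ofReal
  have hi2 : ∫ p, T p * conj (T p) ∂(gaussianReal 0 1).prod (gaussianReal 0 1) = 1 := by
    simp only [hsq]
    rw [integral_complex_ofReal, integral_div, integral_add (h2.comp_fst _) (h2.comp_snd _),
      integral_fun_fst (fun x : ℝ => x ^ 2), integral_fun_snd (fun x : ℝ => x ^ 2)]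
    simp [hvar]
  refine ⟨fun _ => measurable_id, fun _ => ?_, fun _ => ?_, fun _ _ => ?_, fun _ => ?_,
    fun i j h => (h rfl).elim⟩
  · refine (integrable_map_measure aestronglyMeasurable_id hTm.aemeasurable).2 ?_
    exact ((hi1.comp_fst _).add ((hi1.comp_snd _).mul_const _)).div_const _
  · exact (integral_map hTm.aemeasurable aestronglyMeasurable_id).trans hi
  · exact (integrable_map_measure hmul.aestronglyMeasurable hTm.aemeasurable).2 hint2
  · exact (integral_map hTm.aemeasurable hmul.aestronglyMeasurable).trans hi2

lemma isWhite_stdCGaussPi (ι : Type) [Fintype ι] :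
    IsWhite (stdCGaussPi ι) (fun i x => x i) :=
  isWhite_stdCGauss.pi.comp_injective (f := fun i => (i, ())) fun _ _ h => congrArg Prod.fst h

lemma isWhite_stdCGaussMat (ι κ : Type) [Fintype ι] [Fintype κ] :
    IsWhite (stdCGaussMat ι κ) (fun (s : ι × κ) x => x s.1 s.2) :=
  (isWhite_stdCGaussPi κ).pi

/-- The coefficient of `conj (D n a) * c m` in the `i`-th coordinate of the cascaded channel,
indexed by `t = ((n, a), m)`. -/
noncomputable def chanCoef {N L : ℕ} (βm : ℝ) (SRISm : Matrix (Fin N) (Fin N) ℂ)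
    (SAP : Matrix (Fin L) (Fin L) ℂ) (Φ : Matrix (Fin N) (Fin N) ℂ)
    (βu : ℝ) (SRISu : Matrix (Fin N) (Fin N) ℂ) (i : Fin L) (t : (Fin N × Fin L) × Fin N) : ℂ :=
  (Real.sqrt βm : ℂ) * (Real.sqrt βu : ℂ) *
    (SAPᴴ i t.1.2 * (SRISmᴴ * Φ * SRISu) t.1.1 t.2)

lemma hChan_apply {N L : ℕ} (βm : ℝ) (SRISm : Matrix (Fin N) (Fin N) ℂ)
    (SAP : Matrix (Fin L) (Fin L) ℂ) (Φ : Matrix (Fin N) (Fin N) ℂ)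
    (βu : ℝ) (SRISu : Matrix (Fin N) (Fin N) ℂ)
    (d : Fin N → Fin L → ℂ) (c : Fin N → ℂ) (i : Fin L) :
    hChan βm SRISm SAP Φ βu SRISu d c i =
      ∑ t, chanCoef βm SRISm SAP Φ βu SRISu i t * (conj (d t.1.1 t.1.2) * c t.2) := by
  have h : hChan βm SRISm SAP Φ βu SRISu d c = ((Real.sqrt βm : ℂ) * (Real.sqrt βu : ℂ)) •
      (SAPᴴ *ᵥ ((Matrix.of d)ᴴ *ᵥ ((SRISmᴴ * Φ * SRISu) *ᵥ c))) := by
    simp only [hChan, Wmat, qVec, conjTranspose_smul, conjTranspose_mul, mulVec_smul,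
      mulVec_mulVec, Matrix.smul_mul, smul_mulVec, smul_smul, Matrix.mul_assoc, Complex.star_def,
      Complex.conj_ofReal, mul_comm]
  rw [h]
  simp only [Pi.smul_apply, mulVec, dotProduct, smul_eq_mul, Finset.mul_sum, chanCoef,
    Fintype.sum_prod_type, conjTranspose_apply, of_apply, Complex.star_def]
  rw [Finset.sum_comm]
  refine Finset.sum_congr rfl fun n _ => Finset.sum_congr rfl fun a _ =>
    Finset.sum_congr rfl fun m _ => ?_
  ring

lemma sum_chanCoef_mul_conj {N L : ℕ} {βm : ℝ} (hβm : 0 ≤ βm) {SRISm : Matrix (Fin N) (Fin N) ℂ}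
    (hSRISm : SRISm.IsHermitian) {SAP : Matrix (Fin L) (Fin L) ℂ} (hSAP : SAP.IsHermitian)
    (Φ : Matrix (Fin N) (Fin N) ℂ) {βu : ℝ} (hβu : 0 ≤ βu) {SRISu : Matrix (Fin N) (Fin N) ℂ}
    (hSRISu : SRISu.IsHermitian) (i j : Fin L) :
    ∑ t, chanCoef βm SRISm SAP Φ βu SRISu i t * conj (chanCoef βm SRISm SAP Φ βu SRISu j t) =
      (Rtil βm βu (SRISm * SRISm) Φ (SRISu * SRISu)).trace * (SAP * SAP) i j := by
  set A := SRISmᴴ * Φ * SRISu with hA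
  have htr : (SRISm * SRISm * Φ * (SRISu * SRISu) * Φᴴ).trace = ∑ n, ∑ m, A n m * conj (A n m) := by
    have h : (A * Aᴴ).trace = ∑ n, ∑ m, A n m * conj (A n m) := by
      simp only [trace, diag_apply, mul_apply, conjTranspose_apply, Complex.star_def]
    rw [← h, hA]
    simp only [conjTranspose_mul, hSRISm.eq, hSRISu.eq]
    rw [← Matrix.mul_assoc (SRISm * Φ * SRISu), ← Matrix.mul_assoc _ Φᴴ SRISm,
      trace_mul_comm _ SRISm]
    simp only [Matrix.mul_assoc]
  have hβ : (Real.sqrt βm : ℂ) * Real.sqrt βu * ((Real.sqrt βm : ℂ) * Real.sqrt βu) =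
      ((βm * βu : ℝ) : ℂ) := by
    norm_cast
    nlinarith [Real.mul_self_sqrt hβm, Real.mul_self_sqrt hβu,
      mul_mul_mul_comm √βm √βu √βm √βu]
  have hS : (SAP * SAP) i j = ∑ a, SAPᴴ i a * conj (SAPᴴ j a) := by
    nth_rw 1 [← hSAP.eq]
    simp only [mul_apply, conjTranspose_apply, Complex.star_def, Complex.conj_conj]
  rw [Rtil, trace_smul, htr, smul_eq_mul, ← hβ, hS]
  simp only [chanCoef, ← hA, Fintype.sum_prod_type, map_mul, Complex.conj_ofReal, Finset.mul_sum,
    Finset.sum_mul]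
  refine Finset.sum_comm.trans (Finset.sum_congr rfl fun a _ => Finset.sum_congr rfl fun n _ =>
    Finset.sum_congr rfl fun m _ => ?_)
  ring

/-- In the uplink pilot model,
`E[y_mk h_mkᴴ] = √(pτ) · R_mk`. -/
theorem pilot_cross_covariance
    {Ω : Type} [MeasurableSpace Ω] (μ : Measure Ω) [IsProbabilityMeasure μ]
    (N L : ℕ) (K : Type) [Fintype K]
    -- AP-side statistics: path loss and PSD correlation matrices with their PSD square roots
    (βm : ℝ) (hβm : 0 < βm)
    (SRISm RRISm : Matrix (Fin N) (Fin N) ℂ)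
    (hSRISm : SRISm.PosSemidef) (hRRISm : SRISm * SRISm = RRISm)
    (SAP RAP : Matrix (Fin L) (Fin L) ℂ)
    (hSAP : SAP.PosSemidef) (hRAP : SAP * SAP = RAP)
    -- UE-side statistics
    (βu : K → ℝ) (hβu : ∀ l, 0 < βu l)
    (SRISu RRISu : K → Matrix (Fin N) (Fin N) ℂ)
    (hSRISu : ∀ l, (SRISu l).PosSemidef) (hRRISu : ∀ l, SRISu l * SRISu l = RRISu l)
    (Φ : K → Matrix (Fin N) (Fin N) ℂ)
    -- random sources: mutually independent standard complex Gaussians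
    (D : Ω → Fin N → Fin L → ℂ) (c : K → Ω → Fin N → ℂ) (z : Ω → Fin L → ℂ)
    (hD : Measurable D) (hc : ∀ l, Measurable (c l)) (hz : Measurable z)
    (hlaw : μ.map (fun ω => (D ω, fun l => c l ω, z ω))
      = (stdCGaussMat (Fin N) (Fin L)).prod
          ((stdCGaussMat K (Fin N)).prod (stdCGaussPi (Fin L))))
    -- pilot parameters
    (p τ : ℝ) (hp : 0 < p) (hτ : 0 < τ)
    (Pk : Finset K) (k : K) (hk : k ∈ Pk)
    -- the cascaded channels, their covariance matrices, and the pilot observation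
    (h : K → Ω → Fin L → ℂ)
    (hh : ∀ l ω, h l ω = hChan βm SRISm SAP (Φ l) (βu l) (SRISu l) (D ω) (c l ω))
    (Rm : K → Matrix (Fin L) (Fin L) ℂ)
    (hRm : ∀ l, Rm l = (Rtil βm (βu l) RRISm (Φ l) (RRISu l)).trace • RAP)
    (y : Ω → Fin L → ℂ)
    (hy : ∀ ω, y ω = (Real.sqrt (p * τ) : ℂ) • (∑ l ∈ Pk, h l ω) + z ω)
    :
    matExp μ (fun ω => Matrix.vecMulVec (y ω) (star (h k ω)))
      = (Real.sqrt (p * τ) : ℂ) • Rm k := by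
  subst hRRISm hRAP
  obtain rfl : (fun l => SRISu l * SRISu l) = RRISu := funext hRRISu
  have hT : MeasurePreserving (fun ω => (D ω, fun l => c l ω, z ω)) μ
      ((stdCGaussMat (Fin N) (Fin L)).prod
        ((stdCGaussMat K (Fin N)).prod (stdCGaussPi (Fin L)))) :=
    ⟨hD.prodMk ((measurable_pi_lambda _ hc).prodMk hz), hlaw⟩
  have hDw := isWhite_stdCGaussMat (Fin N) (Fin L)
  have hcw := (isWhite_stdCGaussMat K (Fin N)).comp_measurePreserving
    (measurePreserving_fst (ν := stdCGaussPi (Fin L)))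
  have hV := (hDw.conj_mul_prod hcw).comp_measurePreserving hT
  set b := fun l => chanCoef βm SRISm SAP (Φ l) (βu l) (SRISu l) with hb
  set ι : K → (Fin N × Fin L) × Fin N → (Fin N × Fin L) × (K × Fin N) :=
    fun l t => (t.1, (l, t.2)) with hι
  have hhV : ∀ l ω i, h l ω i =
      ∑ t, b l i t * (conj (D ω (ι l t).1.1 (ι l t).1.2) * c (ι l t).2.1 ω (ι l t).2.2) :=
    fun l ω i => by rw [hh, hChan_apply]
  have hhint : ∀ l i j, Integrable (fun ω => h l ω i * conj (h k ω j)) μ := fun l i j => by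
    simp only [hhV]
    exact hV.integrable_sum_mul_conj_sum (ι l) (ι k) (b l i) (b k j)
  have hhne : ∀ l i j, l ≠ k → ∫ ω, h l ω i * conj (h k ω j) ∂μ = 0 := fun l i j hlk => by
    simp only [hhV]
    refine (hV.integral_sum_mul_conj_sum (ι l) (ι k) (b l i) (b k j)).trans ?_
    refine Finset.sum_eq_zero fun s _ => Finset.sum_eq_zero fun t _ => ?_
    rw [hV.integral_mul_conj_of_ne _ _ fun e => hlk (congrArg (fun u => u.2.1) e), mul_zero]
  have hhself : ∀ i j, ∫ ω, h k ω i * conj (h k ω j) ∂μ = Rm k i j := fun i j => by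
    simp only [hhV]
    have hinj : (ι k).Injective := fun s t hst =>
      Prod.ext (congrArg (fun u => u.1) hst) (congrArg (fun u => u.2.2) hst)
    refine (hV.integral_sum_mul_conj_sum_of_injective hinj (b k i) (b k j)).trans ?_
    rw [hRm, Matrix.smul_apply, smul_eq_mul]
    exact sum_chanCoef_mul_conj hβm.le hSRISm.isHermitian hSAP.isHermitian (Φ k) (hβu k).le
      (hSRISu k).isHermitian i j
  have hzc : ∀ i s, Integrable (fun ω => z ω i *
        conj (conj (D ω (ι k s).1.1 (ι k s).1.2) * c (ι k s).2.1 ω (ι k s).2.2)) μ ∧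
      ∫ ω, z ω i * conj (conj (D ω (ι k s).1.1 (ι k s).1.2) * c (ι k s).2.1 ω (ι k s).2.2) ∂μ
        = 0 := fun i s => by
    have hcz : Integrable (fun x : (K → Fin N → ℂ) × (Fin L → ℂ) =>
        conj (x.1 (ι k s).2.1 (ι k s).2.2) * x.2 i)
        ((stdCGaussMat K (Fin N)).prod (stdCGaussPi (Fin L))) :=
      (integrable_conj ((isWhite_stdCGaussMat K (Fin N)).integrable (ι k s).2)).mul_prod
        ((isWhite_stdCGaussPi (Fin L)).integrable i)
    have hF := (hDw.integrable (ι k s).1).mul_prod hcz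
    have hF0 := integral_prod_mul (μ := stdCGaussMat (Fin N) (Fin L))
      (ν := (stdCGaussMat K (Fin N)).prod (stdCGaussPi (Fin L)))
      (fun x => x (ι k s).1.1 (ι k s).1.2) (fun x => conj (x.1 (ι k s).2.1 (ι k s).2.2) * x.2 i)
    rw [hDw.integral_eq_zero (ι k s).1, zero_mul, ← hT.map_eq,
      integral_map hT.measurable.aemeasurable
        (by rw [hT.map_eq]; exact hF.aestronglyMeasurable)] at hF0
    have e : (fun ω => z ω i * conj (conj (D ω (ι k s).1.1 (ι k s).1.2) *
        c (ι k s).2.1 ω (ι k s).2.2)) = fun ω => D ω (ι k s).1.1 (ι k s).1.2 *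
        (conj (c (ι k s).2.1 ω (ι k s).2.2) * z ω i) := by
      ext ω
      rw [map_mul, Complex.conj_conj]
      ring
    rw [e]
    exact ⟨hT.integrable_comp_of_integrable hF, hF0⟩
  have hzh : ∀ i j, Integrable (fun ω => z ω i * conj (h k ω j)) μ ∧
      ∫ ω, z ω i * conj (h k ω j) ∂μ = 0 := fun i j => by
    have e : (fun ω => z ω i * conj (h k ω j)) = fun ω => ∑ t, conj (b k j t) * (z ω i *
        conj (conj (D ω (ι k t).1.1 (ι k t).1.2) * c (ι k t).2.1 ω (ι k t).2.2)) := by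
      ext ω
      rw [hhV, map_sum, Finset.mul_sum]
      exact Finset.sum_congr rfl fun t _ => by rw [map_mul]; ring
    have hi := fun t => ((hzc i t).1.const_mul (conj (b k j t)))
    rw [e]
    refine ⟨integrable_finsetSum _ fun t _ => hi t, ?_⟩
    rw [integral_finsetSum _ fun t _ => hi t]
    exact Finset.sum_eq_zero fun t _ => by rw [integral_const_mul, (hzc i t).2, mul_zero]
  ext i j
  have e : ∀ ω, vecMulVec (y ω) (star (h k ω)) i j = (Real.sqrt (p * τ) : ℂ) *
      (∑ l ∈ Pk, h l ω i * conj (h k ω j)) + z ω i * conj (h k ω j) := fun ω => by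
    rw [vecMulVec_apply, hy, Pi.add_apply, Pi.smul_apply, Finset.sum_apply, Pi.star_apply,
      smul_eq_mul, Complex.star_def, add_mul, mul_assoc, Finset.sum_mul]
  simp only [matExp, of_apply, e]
  rw [integral_add ((integrable_finsetSum _ fun l _ => hhint l i j).const_mul _) (hzh i j).1,
    (hzh i j).2, add_zero, integral_const_mul, integral_finsetSum _ fun l _ => hhint l i j,
    Finset.sum_eq_single_of_mem k hk fun l _ hlk => hhne l i j hlk, hhself, Matrix.smul_apply, smul_eq_mul]
end
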